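/- For 0 ≤ k ≤ ℓ let X_k be the diagonal operator on H given by X_k e_γ = q^{γ(1)+…+γ(k)} e_γ (so X₀ is the identity). Then: (i) Z_k Z_k^* = X_{k−1}² − X_k² for every 1 ≤ k ≤ ℓ; (ii) Z_{ℓ+1} Z_{ℓ+1}^* = X_ℓ²; and (iii) each X_k (1 ≤ k ≤ ℓ) belongs to A, the smallest closed star-subalgebra of the bounded operators on H containing Z₁,…,Z_{ℓ+1}. -/

import Mathlib

open scoped BigOperators InnerProductSpace

noncomputable section

/-- The index set `Γ = ℕ^ℓ × ℤ`. -/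
abbrev Gamma (ℓ : ℕ) : Type := (Fin ℓ → ℕ) × ℤ

/-- The Hilbert space `H = ℓ²(Γ)`. -/
abbrev Hsp (ℓ : ℕ) := lp (fun _ : Gamma ℓ => ℂ) 2

/-- The standard orthonormal basis vector `e_γ`. -/
def e (ℓ : ℕ) (γ : Gamma ℓ) : Hsp ℓ := lp.single 2 γ 1

/-- `ε_k ∈ Γ`: the element whose `k`-th coordinate is `1` and all other coordinates are `0`
(`k` is zero-indexed: `k : Fin (ℓ+1)` corresponds to the coordinate `k+1` of the paper). -/
def eps (ℓ : ℕ) (k : Fin (ℓ+1)) : Gamma ℓ :=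
  if h : (k : ℕ) < ℓ then (Pi.single ⟨(k : ℕ), h⟩ 1, 0) else (0, 1)

/-- The `k`-th coordinate of `γ ∈ Γ`, viewed in `ℤ` (zero-indexed). -/
def coord {ℓ : ℕ} (γ : Gamma ℓ) (k : Fin (ℓ+1)) : ℤ :=
  if h : (k : ℕ) < ℓ then (γ.1 ⟨(k : ℕ), h⟩ : ℤ) else γ.2

/-- `γ(1) + … + γ(k−1)` (sum of the coordinates strictly before position `k`). -/
def sumBelow {ℓ : ℕ} (k : Fin (ℓ+1)) (γ : Gamma ℓ) : ℕ :=
  ∑ j ∈ Finset.univ.filter (fun j : Fin ℓ => (j : ℕ) < (k : ℕ)), γ.1 j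

/-- The growth condition `|d(γ+ε_k) − d(γ)| ≤ c·q^{−(γ(1)+…+γ(k−1))}` for all `γ` and `k`. -/
def GrowthCondition (ℓ : ℕ) (q c : ℝ) (d : Gamma ℓ → ℝ) : Prop :=
  ∀ (k : Fin (ℓ+1)) (γ : Gamma ℓ),
    |d (γ + eps ℓ k) - d γ| ≤ c * (q ^ sumBelow k γ)⁻¹

/-- The coefficient `c_k(γ)`: for `1 ≤ k ≤ ℓ` (i.e. `(k:ℕ) < ℓ` in zero-indexing),
`c_k(γ) = q^{γ(1)+…+γ(k−1)}·√(1 − q^{2(γ(k)+1)})`, and `c_{ℓ+1}(γ) = q^{γ(1)+…+γ(ℓ)}`. -/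
def ck (ℓ : ℕ) (q : ℝ) (k : Fin (ℓ+1)) (γ : Gamma ℓ) : ℝ :=
  q ^ sumBelow k γ *
    (if h : (k : ℕ) < ℓ then Real.sqrt (1 - q ^ (2 * (γ.1 ⟨(k : ℕ), h⟩ + 1))) else 1)

lemma e_apply {ℓ : ℕ} (γ δ : Gamma ℓ) : (e ℓ γ : Gamma ℓ → ℂ) δ = if δ = γ then 1 else 0 := by
  rw [e, lp.single_apply, Pi.single_apply]

lemma inner_e_left {ℓ : ℕ} (γ : Gamma ℓ) (f : Hsp ℓ) : ⟪e ℓ γ, f⟫_ℂ = f γ := by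
  rw [e, lp.inner_single_left]
  simp

lemma ext_of_apply_e {ℓ : ℕ} {S T : Hsp ℓ →L[ℂ] Hsp ℓ}
    (h : ∀ γ, S (e ℓ γ) = T (e ℓ γ)) : S = T := by
  refine lp.ext_continuousLinearMap (𝕜 := ℂ) ENNReal.ofNat_ne_top fun γ => ?_
  ext1
  simpa [e] using h γ

section Adjoint

open ContinuousLinearMap

variable {ℓ : ℕ} {T : Hsp ℓ →L[ℂ] Hsp ℓ} {σ : Gamma ℓ → Gamma ℓ} {w : Gamma ℓ → ℝ}

lemma adjoint_apply_e_apply (hT : ∀ γ, T (e ℓ γ) = (w γ : ℂ) • e ℓ (σ γ)) (γ δ : Gamma ℓ) :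
    (adjoint T (e ℓ γ) : Gamma ℓ → ℂ) δ = if σ δ = γ then (w δ : ℂ) else 0 := by
  rw [← inner_e_left, adjoint_inner_right, hT, inner_smul_left, inner_e_left, e_apply]
  split_ifs <;> simp

lemma adjoint_apply_e (hσ : Function.Injective σ)
    (hT : ∀ γ, T (e ℓ γ) = (w γ : ℂ) • e ℓ (σ γ)) (γ : Gamma ℓ) :
    adjoint T (e ℓ (σ γ)) = (w γ : ℂ) • e ℓ γ := by
  ext δ
  rw [adjoint_apply_e_apply hT, lp.coeFn_smul, Pi.smul_apply, e_apply]
  by_cases h : δ = γ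
  · simp [h]
  · simp [h, hσ.eq_iff]

lemma adjoint_apply_e_of_notMem_range (hT : ∀ γ, T (e ℓ γ) = (w γ : ℂ) • e ℓ (σ γ))
    {γ : Gamma ℓ} (hγ : γ ∉ Set.range σ) : adjoint T (e ℓ γ) = 0 := by
  ext δ
  rw [adjoint_apply_e_apply hT, if_neg fun h => hγ ⟨δ, h⟩]
  rfl

/-- A weighted shift `T` satisfies `T T^* = D` for the diagonal operator `D` carrying the squared
weights on the range of the shift. -/
lemma comp_adjoint_eq_of_weightedShift {D : Hsp ℓ →L[ℂ] Hsp ℓ} {d : Gamma ℓ → ℝ}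
    (hσ : Function.Injective σ) (hT : ∀ γ, T (e ℓ γ) = (w γ : ℂ) • e ℓ (σ γ))
    (hD : ∀ γ, D (e ℓ γ) = (d γ : ℂ) • e ℓ γ) (hwd : ∀ γ, d (σ γ) = w γ ^ 2)
    (hd : ∀ γ, γ ∉ Set.range σ → d γ = 0) : T ∘L adjoint T = D := by
  refine ext_of_apply_e fun γ => ?_
  rw [comp_apply, hD]
  by_cases hγ : γ ∈ Set.range σ
  · obtain ⟨γ, rfl⟩ := hγ
    rw [adjoint_apply_e hσ hT, map_smul, hT, smul_smul, hwd]
    push_cast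
    rw [sq]
  · rw [adjoint_apply_e_of_notMem_range hT hγ, map_zero, hd γ hγ, Complex.ofReal_zero, zero_smul]

end Adjoint

section Diagonal

open ContinuousLinearMap

variable {ℓ : ℕ} {D : Hsp ℓ →L[ℂ] Hsp ℓ} {d : Gamma ℓ → ℝ}

lemma adjoint_eq_self_of_diagonal (hD : ∀ γ, D (e ℓ γ) = (d γ : ℂ) • e ℓ γ) : adjoint D = D :=
  ext_of_apply_e fun γ =>
    (adjoint_apply_e (σ := id) Function.injective_id hD γ).trans (hD γ).symm

lemma diagonal_apply (hD : ∀ γ, D (e ℓ γ) = (d γ : ℂ) • e ℓ γ) (f : Hsp ℓ) (γ : Gamma ℓ) :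
    (D f : Gamma ℓ → ℂ) γ = d γ * f γ := by
  rw [← inner_e_left, ← adjoint_inner_left, adjoint_eq_self_of_diagonal hD, hD, inner_smul_left,
    inner_e_left, Complex.conj_ofReal]

lemma nonneg_of_diagonal (hD : ∀ γ, D (e ℓ γ) = (d γ : ℂ) • e ℓ γ) (hd : ∀ γ, 0 ≤ d γ) :
    0 ≤ D := by
  rw [nonneg_iff_isPositive, isPositive_def']
  refine ⟨adjoint_eq_self_of_diagonal hD, fun f => ?_⟩
  have h := Complex.hasSum_re (lp.hasSum_inner (𝕜 := ℂ) (D f) f)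
  refine h.nonneg fun γ => ?_
  rw [diagonal_apply hD, ← smul_eq_mul, inner_smul_left, Complex.conj_ofReal, Complex.re_ofReal_mul,
    ← RCLike.re_eq_complex_re]
  exact mul_nonneg (hd γ) inner_self_nonneg

lemma comp_self_apply_e (hD : ∀ γ, D (e ℓ γ) = (d γ : ℂ) • e ℓ γ) (γ : Gamma ℓ) :
    (D ∘L D) (e ℓ γ) = ((d γ ^ 2 : ℝ) : ℂ) • e ℓ γ := by
  rw [comp_apply, hD, map_smul, hD, smul_smul]
  push_cast
  rw [sq]

end Diagonal

lemma mem_of_nonneg_of_mul_self_mem {A : Type*} [CStarAlgebra A] [PartialOrder A]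
    [StarOrderedRing A] {S : StarSubalgebra ℂ A} (hS : IsClosed (S : Set A)) {a : A}
    (ha : 0 ≤ a) (h : a * a ∈ S) : a ∈ S := by
  have haa : 0 ≤ a * a := by simpa [ha.isSelfAdjoint.star_eq] using star_mul_self_nonneg a
  rw [← CFC.sqrt_mul_self a ha, CFC.sqrt_eq_real_sqrt (a * a) haa, cfcₙ_eq_cfc]
  exact cfc_mem (𝕜' := ℂ) (hs := hS) Real.sqrt h

lemma eps_castSucc {ℓ : ℕ} (k : Fin ℓ) : eps ℓ k.castSucc = (Pi.single k 1, 0) := by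
  simp [eps]

lemma eps_last (ℓ : ℕ) : eps ℓ (Fin.last ℓ) = (0, 1) := by
  simp [eps]

/-- The sum `γ(1) + … + γ(k)` of the first `k` coordinates of `γ`. -/
def partialSum {ℓ : ℕ} (k : ℕ) (γ : Gamma ℓ) : ℕ :=
  ∑ j ∈ Finset.univ.filter (fun j : Fin ℓ => (j : ℕ) < k), γ.1 j

lemma partialSum_succ {ℓ : ℕ} (k : Fin ℓ) (γ : Gamma ℓ) :
    partialSum (k + 1) γ = partialSum k γ + γ.1 k := by
  have h : Finset.univ.filter (fun j : Fin ℓ => (j : ℕ) < k + 1) =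
      insert k (Finset.univ.filter (fun j : Fin ℓ => (j : ℕ) < k)) := by
    ext j
    simp [Fin.ext_iff]
    omega
  rw [partialSum, h, Finset.sum_insert (by simp), add_comm, partialSum]

lemma partialSum_add_eps {ℓ : ℕ} (k : Fin (ℓ + 1)) (γ : Gamma ℓ) :
    partialSum k (γ + eps ℓ k) = partialSum k γ := by
  refine Finset.sum_congr rfl fun j hj => ?_
  have hj : (j : ℕ) < k := (Finset.mem_filter.1 hj).2
  induction k using Fin.lastCases with
  | last => simp [eps_last]
  | cast k =>
    have : j ≠ k := fun h => by simp [h] at hj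
    simp [eps_castSucc, this]

lemma ck_castSucc (ℓ : ℕ) (q : ℝ) (k : Fin ℓ) (γ : Gamma ℓ) :
    ck ℓ q k.castSucc γ = q ^ partialSum k γ * √(1 - q ^ (2 * (γ.1 k + 1))) := by
  simp [ck, sumBelow, partialSum]

lemma ck_last (ℓ : ℕ) (q : ℝ) (γ : Gamma ℓ) : ck ℓ q (Fin.last ℓ) γ = q ^ partialSum ℓ γ := by
  simp [ck, sumBelow, partialSum]

lemma mem_range_add_eps_castSucc {ℓ : ℕ} (k : Fin ℓ) {γ : Gamma ℓ} (hγ : γ.1 k ≠ 0) :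
    γ ∈ Set.range (· + eps ℓ k.castSucc) := by
  refine ⟨(γ.1 - Pi.single k 1, γ.2), ?_⟩
  simp only [eps_castSucc, Prod.mk_add_mk, add_zero]
  refine Prod.ext (funext fun j => ?_) rfl
  by_cases hj : j = k
  · subst hj
    simpa using Nat.sub_add_cancel (Nat.one_le_iff_ne_zero.2 hγ)
  · simp [hj]

open ContinuousLinearMap in
/-- with `X_k` the diagonal operator `e_γ ↦ q^{γ(1)+…+γ(k)} e_γ`
(`X₀ = 1`), one has `Z_k Z_k^* = X_{k−1}² − X_k²` for `1 ≤ k ≤ ℓ`,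
`Z_{ℓ+1} Z_{ℓ+1}^* = X_ℓ²`, and each `X_k` (`1 ≤ k ≤ ℓ`) belongs to the smallest closed
star-subalgebra `A` of the bounded operators on `H` containing `Z₁, …, Z_{ℓ+1}`. -/
theorem stmt15 (ℓ : ℕ) (hℓ : 1 ≤ ℓ) (q : ℝ) (hq : 0 < q) (hq1 : q < 1)
    (Z : Fin (ℓ+1) → Hsp ℓ →L[ℂ] Hsp ℓ)
    (hZ : ∀ (k : Fin (ℓ+1)) (γ : Gamma ℓ),
      Z k (e ℓ γ) = ((ck ℓ q k γ : ℝ) : ℂ) • e ℓ (γ + eps ℓ k))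
    (X : ℕ → Hsp ℓ →L[ℂ] Hsp ℓ)
    (hX : ∀ k : ℕ, k ≤ ℓ → ∀ γ : Gamma ℓ,
      X k (e ℓ γ) =
        ((q ^ (∑ j ∈ Finset.univ.filter (fun j : Fin ℓ => (j : ℕ) < k), γ.1 j) : ℝ) : ℂ)
          • e ℓ γ) :
    (∀ k : Fin ℓ,
      Z k.castSucc ∘L adjoint (Z k.castSucc) =
        X (k : ℕ) ∘L X (k : ℕ) - X ((k : ℕ) + 1) ∘L X ((k : ℕ) + 1)) ∧
    (Z (Fin.last ℓ) ∘L adjoint (Z (Fin.last ℓ)) = X ℓ ∘L X ℓ) ∧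
    (∀ k : ℕ, 1 ≤ k → k ≤ ℓ →
      X k ∈ (StarAlgebra.adjoin ℂ (Set.range Z)).topologicalClosure) := by
  have hX' : ∀ k ≤ ℓ, ∀ γ, X k (e ℓ γ) = ((q ^ partialSum k γ : ℝ) : ℂ) • e ℓ γ := hX
  have hshift : ∀ k : Fin ℓ,
      Z k.castSucc ∘L adjoint (Z k.castSucc) =
        X (k : ℕ) ∘L X (k : ℕ) - X ((k : ℕ) + 1) ∘L X ((k : ℕ) + 1) := fun k => by
    refine comp_adjoint_eq_of_weightedShift
      (d := fun γ => (q ^ partialSum k γ) ^ 2 - (q ^ partialSum (k + 1) γ) ^ 2)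
      (add_left_injective _) (hZ _) (fun γ => ?_) (fun γ => ?_) fun γ hγ => ?_
    · rw [sub_apply, comp_self_apply_e (hX' _ k.2.le), comp_self_apply_e (hX' _ k.2), ← sub_smul,
        ← Complex.ofReal_sub]
    · have hsum : partialSum k (γ + eps ℓ k.castSucc) = partialSum k γ :=
        partialSum_add_eps k.castSucc γ
      have hcoord : (γ + eps ℓ k.castSucc).1 k = γ.1 k + 1 := by simp [eps_castSucc]
      have hle : q ^ (2 * (γ.1 k + 1)) ≤ 1 := pow_le_one₀ hq.le hq1.le
      rw [partialSum_succ, hsum, hcoord, ck_castSucc, mul_pow, Real.sq_sqrt (sub_nonneg.2 hle)]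
      ring
    · have h0 : γ.1 k = 0 := by
        by_contra h
        exact hγ (mem_range_add_eps_castSucc k h)
      simp [partialSum_succ, h0]
  refine ⟨hshift, ?_, fun k _ hk => ?_⟩
  · refine comp_adjoint_eq_of_weightedShift (d := fun γ => (q ^ partialSum ℓ γ) ^ 2)
      (add_left_injective _) (hZ _) (comp_self_apply_e (hX' ℓ le_rfl)) (fun γ => ?_)
      fun γ hγ => (hγ ⟨γ - eps ℓ (Fin.last ℓ), ?_⟩).elim
    · rw [ck_last]
      exact congrArg (fun n => (q ^ n) ^ 2) (partialSum_add_eps (Fin.last ℓ) γ)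
    · simp [eps_last, Prod.ext_iff]
  · have hmem : ∀ j ≤ ℓ, X j * X j ∈ (StarAlgebra.adjoin ℂ (Set.range Z)).topologicalClosure := by
      intro j
      induction j with
      | zero =>
        intro h0
        have : X 0 = 1 := ext_of_apply_e fun γ => by simp [hX' 0 h0, partialSum]
        rw [this, mul_one]
        exact one_mem _
      | succ j ih =>
        intro hj
        have hZmem : Z (Fin.castSucc ⟨j, hj⟩) ∈
            (StarAlgebra.adjoin ℂ (Set.range Z)).topologicalClosure :=
          StarSubalgebra.le_topologicalClosure _
            (StarAlgebra.subset_adjoin ℂ _ (Set.mem_range_self _))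
        have h : X j * X j - X (j + 1) * X (j + 1) =
            Z (Fin.castSucc ⟨j, hj⟩) * star (Z (Fin.castSucc ⟨j, hj⟩)) := (hshift ⟨j, hj⟩).symm
        rw [← sub_sub_cancel (X j * X j) (X (j + 1) * X (j + 1)), h]
        exact sub_mem (ih (by omega)) (mul_mem hZmem (star_mem hZmem))
    exact mem_of_nonneg_of_mul_self_mem (StarSubalgebra.isClosed_topologicalClosure _)
      (nonneg_of_diagonal (hX' k hk) fun γ => by positivity) (hmem k hk)
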